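/- Let A be a measurable 3-sum-free subset of [0,1] with μ(A) = 77/177. Then, up to the choice of endpoints, A is contained in one of the seven maximal extremal sets: there exist x ∈ {8/177, 4/59}, y ∈ {28/177, 14/59}, z ∈ {2/3, 1} with (x,y,z) ≠ (8/177, 14/59, 2/3) such that A ⊆ 𝒜₀ ∪ {x, y, z}. -/

import Mathlib

open MeasureTheory Set

noncomputable def mm (A : Set ℝ) (u v : ℝ) : ℝ := volume.real (A ∩ Icc u v)

def SF (A : Set ℝ) : Prop := ∀ x ∈ A, ∀ y ∈ A, ∀ z ∈ A, x + y ≠ 3 * z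

lemma vol_affine (B : Set ℝ) (c d : ℝ) (hc : c ≠ 0) :
    volume.real ((fun t : ℝ => c * t + d) ⁻¹' B) = |c⁻¹| * volume.real B := by
  have h1 : (fun t : ℝ => c * t + d) ⁻¹' B = (fun t : ℝ => c * t) ⁻¹' ((fun t => t + d) ⁻¹' B) := rfl
  rw [h1, measureReal_def, Real.volume_preimage_mul_left hc, measure_preimage_add_right,
    ENNReal.toReal_mul, ENNReal.toReal_ofReal (abs_nonneg _), measureReal_def]

lemma mm_fin (A : Set ℝ) (u v : ℝ) : volume (A ∩ Icc u v) ≠ ⊤ :=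
  ne_of_lt (lt_of_le_of_lt (measure_mono inter_subset_right) (by simp))

lemma mm_nonneg (A : Set ℝ) (u v : ℝ) : 0 ≤ mm A u v := measureReal_nonneg

lemma mm_le (A : Set ℝ) {u v : ℝ} (h : u ≤ v) : mm A u v ≤ v - u := by
  have : mm A u v ≤ volume.real (Icc u v) :=
    measureReal_mono inter_subset_right (by simp)
  simpa [h] using this

lemma mm_self (A : Set ℝ) (u : ℝ) : mm A u u = 0 :=
  le_antisymm (by simpa using mm_le A (le_refl u)) (mm_nonneg _ _ _)

lemma mm_mono (A : Set ℝ) {u v u' v' : ℝ} (h1 : u' ≤ u) (h2 : v ≤ v') : mm A u v ≤ mm A u' v' :=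
  measureReal_mono (inter_subset_inter_right _ (Icc_subset_Icc h1 h2)) (mm_fin _ _ _)

lemma mm_add {A : Set ℝ} (hm : MeasurableSet A) {u v w : ℝ} (h1 : u ≤ v) (h2 : v ≤ w) :
    mm A u w = mm A u v + mm A v w := by
  have e : A ∩ Icc u w = (A ∩ Icc u v) ∪ (A ∩ Icc v w) := by
    rw [← inter_union_distrib_left, Icc_union_Icc_eq_Icc h1 h2]
  unfold mm
  rw [e, measureReal_union₀ (hm.inter measurableSet_Icc).nullMeasurableSet _ (mm_fin _ _ _) (mm_fin _ _ _)]
  have : (A ∩ Icc u v) ∩ (A ∩ Icc v w) ⊆ {v} := by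
    rintro x ⟨⟨_, h⟩, ⟨_, h'⟩⟩
    exact le_antisymm h.2 h'.1
  exact measure_mono_null this (by simp)

lemma mm_close (A : Set ℝ) (u v u' v' e : ℝ) (h1 : |u - u'| ≤ e) (h2 : |v - v'| ≤ e) :
    mm A u v ≤ mm A u' v' + 2 * e := by
  have he : 0 ≤ e := le_trans (abs_nonneg _) h1
  rw [abs_le] at h1 h2
  have hs : A ∩ Icc u v ⊆ (A ∩ Icc u' v') ∪ (Icc u (u + e) ∪ Icc (v - e) v) := by
    rintro x ⟨hx, hx1, hx2⟩
    by_cases a1 : x ≤ u + e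
    · right; left; exact ⟨hx1, a1⟩
    · by_cases a2 : v - e ≤ x
      · right; right; exact ⟨a2, hx2⟩
      · left; exact ⟨hx, by linarith, by linarith⟩
  have f1 : volume (Icc u (u + e) ∪ Icc (v - e) v) ≠ ⊤ :=
    ne_of_lt (lt_of_le_of_lt (measure_union_le _ _) (by simp))
  calc mm A u v ≤ volume.real ((A ∩ Icc u' v') ∪ (Icc u (u + e) ∪ Icc (v - e) v)) :=
        measureReal_mono hs (ne_of_lt (lt_of_le_of_lt (measure_union_le _ _)
          (ENNReal.add_lt_top.2 ⟨lt_top_iff_ne_top.2 (mm_fin _ _ _), lt_top_iff_ne_top.2 f1⟩)))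
    _ ≤ mm A u' v' + volume.real (Icc u (u + e) ∪ Icc (v - e) v) := measureReal_union_le _ _
    _ ≤ mm A u' v' + (volume.real (Icc u (u + e)) + volume.real (Icc (v - e) v)) := by
        gcongr; exact measureReal_union_le _ _
    _ = mm A u' v' + 2 * e := by
        rw [Real.volume_real_Icc_of_le (by linarith), Real.volume_real_Icc_of_le (by linarith)]; ring

lemma mm_W0 {A : Set ℝ} (hm : MeasurableSet A) (hsf : SF A) {x : ℝ} (hx : x ∈ A) {u v : ℝ}
    (h : u ≤ v) : mm A u v + 3 * mm A ((u + x) / 3) ((v + x) / 3) ≤ v - u := by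
  have e : 3 * mm A ((u + x) / 3) ((v + x) / 3) =
      volume.real ((fun t : ℝ => (1/3) * t + x / 3) ⁻¹' (A ∩ Icc ((u + x) / 3) ((v + x) / 3))) := by
    rw [vol_affine _ _ _ (by norm_num)]
    have : |((1:ℝ)/3)⁻¹| = 3 := by norm_num
    rw [this]; rfl
  rw [e]
  unfold mm
  have hs : (fun t : ℝ => (1/3) * t + x / 3) ⁻¹' (A ∩ Icc ((u + x) / 3) ((v + x) / 3)) ⊆ Icc u v := by
    rintro t ⟨_, h1, h2⟩
    simp only at h1 h2
    exact ⟨by linarith, by linarith⟩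
  rw [← measureReal_union _ _ (mm_fin _ _ _) (ne_of_lt (lt_of_le_of_lt (measure_mono hs) (by simp)))]
  · calc _ ≤ volume.real (Icc u v) := measureReal_mono (union_subset inter_subset_right hs) (by simp)
      _ = v - u := by simp [h]
  · rw [Set.disjoint_left]
    rintro t ⟨ht, _⟩ ⟨ht', _⟩
    exact hsf t ht x hx _ ht' (by ring)
  · exact (by fun_prop : Measurable (fun t : ℝ => (1/3) * t + x / 3)) (hm.inter measurableSet_Icc)

lemma mm_P0 {A : Set ℝ} (hm : MeasurableSet A) (hsf : SF A) {x : ℝ} (hx : x ∈ A) {u v : ℝ}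
    (h : u ≤ v) : mm A u v + mm A (3 * x - v) (3 * x - u) ≤ v - u := by
  have e : mm A (3 * x - v) (3 * x - u) =
      volume.real ((fun t : ℝ => (-1) * t + 3 * x) ⁻¹' (A ∩ Icc (3 * x - v) (3 * x - u))) := by
    rw [vol_affine _ _ _ (by norm_num)]
    have : |((-1:ℝ))⁻¹| = 1 := by norm_num
    rw [this, one_mul]; rfl
  rw [e]
  unfold mm
  have hs : (fun t : ℝ => (-1) * t + 3 * x) ⁻¹' (A ∩ Icc (3 * x - v) (3 * x - u)) ⊆ Icc u v := by
    rintro t ⟨_, h1, h2⟩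
    simp only at h1 h2
    exact ⟨by linarith, by linarith⟩
  rw [← measureReal_union _ _ (mm_fin _ _ _) (ne_of_lt (lt_of_le_of_lt (measure_mono hs) (by simp)))]
  · calc _ ≤ volume.real (Icc u v) := measureReal_mono (union_subset inter_subset_right hs) (by simp)
      _ = v - u := by simp [h]
  · rw [Set.disjoint_left]
    rintro t ⟨ht, _⟩ ⟨ht', _⟩
    exact hsf t ht _ ht' x hx (by ring)
  · exact (by fun_prop : Measurable (fun t : ℝ => (-1) * t + 3 * x)) (hm.inter measurableSet_Icc)

lemma mm_W {A : Set ℝ} (hm : MeasurableSet A) (hsf : SF A) {x : ℝ} (hx : x ∈ closure A) {u v : ℝ}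
    (h : u ≤ v) : mm A u v + 3 * mm A ((u + x) / 3) ((v + x) / 3) ≤ v - u := by
  refine le_of_forall_pos_le_add fun e he => ?_
  obtain ⟨y, hy, hd⟩ := Metric.mem_closure_iff.1 hx (e/2) (by linarith)
  rw [Real.dist_eq] at hd
  have h1 := mm_W0 hm hsf hy h
  have h2 := mm_close A ((u + x) / 3) ((v + x) / 3) ((u + y) / 3) ((v + y) / 3) (e/6)
    (by rw [show (u + x) / 3 - (u + y) / 3 = (x - y)/3 by ring, abs_div, abs_of_pos (by norm_num : (0:ℝ) < 3)]; linarith)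
    (by rw [show (v + x) / 3 - (v + y) / 3 = (x - y)/3 by ring, abs_div, abs_of_pos (by norm_num : (0:ℝ) < 3)]; linarith)
  linarith

lemma mm_P {A : Set ℝ} (hm : MeasurableSet A) (hsf : SF A) {x : ℝ} (hx : x ∈ closure A) {u v : ℝ}
    (h : u ≤ v) : mm A u v + mm A (3 * x - v) (3 * x - u) ≤ v - u := by
  refine le_of_forall_pos_le_add fun e he => ?_
  obtain ⟨y, hy, hd⟩ := Metric.mem_closure_iff.1 hx (e/6) (by linarith)
  rw [Real.dist_eq] at hd
  have h1 := mm_P0 hm hsf hy h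
  have h2 := mm_close A (3 * x - v) (3 * x - u) (3 * y - v) (3 * y - u) (e/2)
    (by rw [show (3 * x - v) - (3 * y - v) = 3 * (x - y) by ring, abs_mul, abs_of_pos (by norm_num : (0:ℝ) < 3)]; linarith)
    (by rw [show (3 * x - u) - (3 * y - u) = 3 * (x - y) by ring, abs_mul, abs_of_pos (by norm_num : (0:ℝ) < 3)]; linarith)
  linarith

lemma mm_cont_left (A : Set ℝ) (v : ℝ) : Continuous fun t => mm A t v := by
  refine Metric.continuous_iff.2 fun b e he => ⟨e/3, by linarith, fun a hab => ?_⟩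
  rw [Real.dist_eq] at *
  have h1 := mm_close A a v b v (e/3) hab.le (by simp; linarith)
  have h2 := mm_close A b v a v (e/3) (by rw [abs_sub_comm]; exact hab.le) (by simp; linarith)
  rw [abs_lt]; constructor <;> linarith

lemma mm_cont_right (A : Set ℝ) (u : ℝ) : Continuous fun t => mm A u t := by
  refine Metric.continuous_iff.2 fun b e he => ⟨e/3, by linarith, fun a hab => ?_⟩
  rw [Real.dist_eq] at *
  have h1 := mm_close A u a u b (e/3) (by simp; linarith) hab.le
  have h2 := mm_close A u b u a (e/3) (by simp; linarith) (by rw [abs_sub_comm]; exact hab.le)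
  rw [abs_lt]; constructor <;> linarith

lemma mm_pos_mem {A : Set ℝ} {u v : ℝ} (h : 0 < mm A u v) : ∃ x ∈ A, u ≤ x ∧ x ≤ v := by
  by_contra hc
  push Not at hc
  have : A ∩ Icc u v = ∅ := by
    ext x
    simp only [mem_inter_iff, mem_Icc, mem_empty_iff_false, iff_false, not_and, not_le]
    intro hx h1; exact hc x hx h1
  simp [mm, this] at h

lemma exists_left {A : Set ℝ} (hm : MeasurableSet A) {lo hi : ℝ} (hl : lo ≤ hi)
    (h : 0 < mm A lo hi) : ∃ b, lo < b ∧ b ≤ hi ∧ mm A b hi = 0 ∧ (∀ t, lo ≤ t → t < b → 0 < mm A t b)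
      ∧ b ∈ closure A := by
  set s : Set ℝ := {t | mm A t hi = 0} ∩ Icc lo hi with hs
  have hc : IsCompact s := (isCompact_Icc).inter_left
    (isClosed_eq (mm_cont_left A hi) continuous_const)
  have hne : s.Nonempty := ⟨hi, mm_self A hi, hl, le_refl _⟩
  have hb := hc.sInf_mem hne
  set b := sInf s
  have h1 : lo < b := by
    rcases eq_or_lt_of_le hb.2.1 with e | e
    · have := hb.1; simp only [mem_ofPred_eq] at this; rw [← e] at this; linarith
    · exact e
  have hp : ∀ t, lo ≤ t → t < b → 0 < mm A t b := by
    intro t ht htb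
    have h2 : mm A t hi = mm A t b + mm A b hi := mm_add hm htb.le hb.2.2
    have h3 : mm A b hi = 0 := hb.1
    rcases eq_or_lt_of_le (mm_nonneg A t b) with e | e
    · have : t ∈ s := ⟨by show mm A t hi = 0; linarith, ht, htb.le.trans hb.2.2⟩
      have := csInf_le hc.bddBelow this
      linarith
    · exact e
  refine ⟨b, h1, hb.2.2, hb.1, hp, ?_⟩
  rw [Metric.mem_closure_iff]
  intro e he
  obtain ⟨x, hx, hx1, hx2⟩ := mm_pos_mem (hp (max lo (b - e/2)) (le_max_left _ _) (max_lt h1 (by linarith)))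
  refine ⟨x, hx, ?_⟩
  rw [Real.dist_eq, abs_lt]
  have := (le_max_right lo (b - e/2)).trans hx1
  constructor <;> linarith

lemma exists_right {A : Set ℝ} (hm : MeasurableSet A) {lo hi : ℝ} (hl : lo ≤ hi)
    (h : 0 < mm A lo hi) : ∃ b, lo ≤ b ∧ b < hi ∧ mm A lo b = 0 ∧ (∀ t, t ≤ hi → b < t → 0 < mm A b t)
      ∧ b ∈ closure A := by
  set s : Set ℝ := {t | mm A lo t = 0} ∩ Icc lo hi with hs
  have hc : IsCompact s := (isCompact_Icc).inter_left
    (isClosed_eq (mm_cont_right A lo) continuous_const)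
  have hne : s.Nonempty := ⟨lo, mm_self A lo, le_refl _, hl⟩
  have hb := hc.sSup_mem hne
  set b := sSup s
  have h1 : b < hi := by
    rcases eq_or_lt_of_le hb.2.2 with e | e
    · have := hb.1; simp only [mem_ofPred_eq] at this; rw [e] at this; linarith
    · exact e
  have hp : ∀ t, t ≤ hi → b < t → 0 < mm A b t := by
    intro t ht htb
    have h2 : mm A lo t = mm A lo b + mm A b t := mm_add hm hb.2.1 htb.le
    have h3 : mm A lo b = 0 := hb.1
    rcases eq_or_lt_of_le (mm_nonneg A b t) with e | e
    · have : t ∈ s := ⟨by show mm A lo t = 0; linarith, hb.2.1.trans htb.le, ht⟩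
      have := le_csSup hc.bddAbove this
      linarith
    · exact e
  refine ⟨b, hb.2.1, h1, hb.1, hp, ?_⟩
  rw [Metric.mem_closure_iff]
  intro e he
  obtain ⟨x, hx, hx1, hx2⟩ := mm_pos_mem (hp (min hi (b + e/2)) (min_le_left _ _) (lt_min h1 (by linarith)))
  refine ⟨x, hx, ?_⟩
  rw [Real.dist_eq, abs_lt]
  have := hx2.trans (min_le_right hi (b + e/2))
  constructor <;> linarith

lemma comp_bound {K X : Set ℝ} {α β c : ℝ} (hK : IsCompact K) (hα : α ∈ K) (hKs : K ⊆ Icc α β)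
    (h : ∀ p ∈ K, ∀ v, p ≤ v → v ≤ β → volume (X ∩ Icc p v) ≤ ENNReal.ofReal c * ENNReal.ofReal (v - p)) :
    volume (X ∩ (Icc α β \ K)) ≤ ENNReal.ofReal c * volume (Icc α β \ K) := by
  set K' : Set ℝ := K ∪ {β} with hK'
  have hcK' : IsCompact K' := hK.union isCompact_singleton
  set y : ℝ → ℝ := fun p => sInf (K' ∩ Ioi p) with hy
  have hbd : ∀ p, BddBelow (K' ∩ Ioi p) := fun p => ⟨p, fun t ht => le_of_lt ht.2⟩
  set P : Set ℝ := {p | p ∈ K ∧ p < β ∧ p < y p} with hP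
  have hyβ : ∀ p ∈ P, y p ≤ β := fun p hp => csInf_le (hbd p) ⟨Or.inr rfl, hp.2.1⟩
  have hyK : ∀ p ∈ P, ∀ q ∈ K, p < q → y p ≤ q := fun p hp q hq hpq =>
    csInf_le (hbd p) ⟨Or.inl hq, hpq⟩
  have hdis : P.PairwiseDisjoint fun p => Ioo p (y p) := by
    intro p hp q hq hpq
    show Disjoint (Ioo p (y p)) (Ioo q (y q))
    rw [Set.disjoint_left]
    rintro t ⟨a1, a2⟩ ⟨b1, b2⟩
    rcases lt_or_gt_of_ne hpq with hl | hl
    · have := hyK p hp q hq.1 hl; linarith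
    · have := hyK q hq p hp.1 hl; linarith
  have hcount : P.Countable := hdis.countable_of_Ioo fun p hp => hp.2.2
  have hsub : (⋃ p ∈ P, Ioo p (y p)) ⊆ Icc α β \ K := by
    intro t ht
    simp only [mem_iUnion] at ht
    obtain ⟨p, hp, h1, h2⟩ := ht
    refine ⟨⟨?_, ?_⟩, fun hk => ?_⟩
    · have := (hKs hp.1).1; linarith
    · have := hyβ p hp; linarith
    · have := hyK p hp t hk h1; linarith
  have hcov : Icc α β \ K ⊆ (⋃ p ∈ P, Ioo p (y p)) ∪ {β} := by
    rintro t ⟨⟨h1, h2⟩, h3⟩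
    rcases eq_or_lt_of_le h2 with e | e
    · right; exact e
    left
    have hc1 : IsCompact (K ∩ Iic t) := hK.inter_right isClosed_Iic
    have hp := hc1.sSup_mem ⟨α, hα, h1⟩
    set p := sSup (K ∩ Iic t)
    have hpt : p < t := lt_of_le_of_ne hp.2 (fun e => h3 (e ▸ hp.1))
    have hgap : ∀ q ∈ K, p < q → t < q := by
      intro q hq hpq
      by_contra hc
      have := le_csSup hc1.bddAbove ⟨hq, not_lt.1 hc⟩
      linarith
    have hset : K' ∩ Ioi p = K' ∩ Ici t := by
      ext q
      constructor
      · rintro ⟨hq, hpq⟩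
        refine ⟨hq, ?_⟩
        rcases hq with hq | hq
        · exact (hgap q hq hpq).le
        · rw [mem_singleton_iff] at hq; rw [hq]; exact e.le
      · rintro ⟨hq, hpq⟩
        exact ⟨hq, lt_of_lt_of_le hpt hpq⟩
    have hc2 : IsCompact (K' ∩ Ici t) := hcK'.inter_right isClosed_Ici
    have hm := hc2.sInf_mem ⟨β, Or.inr rfl, e.le⟩
    rw [← hset] at hm
    have hty : t < y p := by
      have h5 : y p ∈ K' ∩ Ioi p := hm
      rcases h5.1 with hq | hq
      · exact hgap _ hq h5.2
      · rw [mem_singleton_iff] at hq; rw [hq]; exact e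
    simp only [mem_iUnion]
    exact ⟨p, ⟨hp.1, hpt.trans e, hpt.trans hty⟩, hpt, hty⟩
  calc volume (X ∩ (Icc α β \ K)) ≤ volume ((⋃ p ∈ P, X ∩ Ioo p (y p)) ∪ {β}) := by
        apply measure_mono
        rintro t ⟨hx, ht⟩
        rcases hcov ht with h1 | h1
        · left
          simp only [mem_iUnion] at h1 ⊢
          obtain ⟨p, hp, h2⟩ := h1
          exact ⟨p, hp, hx, h2⟩
        · right; exact h1
    _ ≤ volume (⋃ p ∈ P, X ∩ Ioo p (y p)) + volume {β} := measure_union_le _ _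
    _ = volume (⋃ p ∈ P, X ∩ Ioo p (y p)) := by simp
    _ ≤ ∑' p : P, volume (X ∩ Ioo (p:ℝ) (y p)) := measure_biUnion_le _ hcount _
    _ ≤ ∑' p : P, ENNReal.ofReal c * volume (Ioo (p:ℝ) (y p)) := by
        apply ENNReal.tsum_le_tsum
        rintro ⟨p, hp⟩
        rw [Real.volume_Ioo]
        exact (measure_mono (inter_subset_inter_right _ Ioo_subset_Icc_self)).trans
          (h p hp.1 _ hp.2.2.le (hyβ p hp))
    _ = ENNReal.ofReal c * volume (⋃ p ∈ P, Ioo p (y p)) := by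
        rw [ENNReal.tsum_mul_left, measure_biUnion hcount hdis (fun _ _ => measurableSet_Ioo)]
    _ ≤ _ := by gcongr

def NN (A : Set ℝ) : Set ℝ := (fun t : ℝ => (1/3) * t + 1 / 3) ⁻¹' A

lemma NN_meas {A : Set ℝ} (hm : MeasurableSet A) : MeasurableSet (NN A) :=
  (by fun_prop : Measurable (fun t : ℝ => (1/3) * t + 1 / 3)) hm

lemma mm_NN (A : Set ℝ) (u v : ℝ) : mm (NN A) u v = 3 * mm A ((u + 1) / 3) ((v + 1) / 3) := by
  have e : NN A ∩ Icc u v =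
      (fun t : ℝ => (1/3) * t + 1 / 3) ⁻¹' (A ∩ Icc ((u + 1) / 3) ((v + 1) / 3)) := by
    ext t
    simp only [NN, mem_inter_iff, mem_preimage, mem_Icc]
    constructor
    · rintro ⟨h1, h2, h3⟩; exact ⟨h1, by linarith, by linarith⟩
    · rintro ⟨h1, h2, h3⟩; exact ⟨h1, by linarith, by linarith⟩
  unfold mm
  rw [e, vol_affine _ _ _ (by norm_num)]
  have : |((1:ℝ)/3)⁻¹| = 3 := by norm_num
  rw [this]

lemma null_NN {A : Set ℝ} (hm : MeasurableSet A) (hsf : SF A) (h1 : 1 ∈ closure A) :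
    volume (A ∩ NN A) = 0 := by
  by_contra hne
  have hd := Besicovitch.ae_tendsto_measure_inter_div (volume : Measure ℝ) (A ∩ NN A)
  have hmi := hm.inter (NN_meas hm)
  have hmem := ae_restrict_mem (μ := (volume : Measure ℝ)) hmi
  have hnb : (ae (volume.restrict (A ∩ NN A))).NeBot := by
    rw [ae_neBot, Ne, Measure.restrict_eq_zero]; exact hne
  obtain ⟨x, hx⟩ := hd.exists
  have hb : ∀ r : ℝ, 0 < r → volume (A ∩ NN A ∩ Metric.closedBall x r) / volume (Metric.closedBall x r)
      ≤ ENNReal.ofReal (1/2) := by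
    intro r hr
    rw [Real.closedBall_eq_Icc, Real.volume_Icc]
    have hle := mm_W hm hsf h1 (u := x - r) (v := x + r) (by linarith)
    rw [← mm_NN] at hle
    have e1 : mm (A ∩ NN A) (x - r) (x + r) ≤ mm A (x-r) (x+r) :=
      measureReal_mono (inter_subset_inter_left _ inter_subset_left) (mm_fin _ _ _)
    have e2 : mm (A ∩ NN A) (x - r) (x + r) ≤ mm (NN A) (x-r) (x+r) :=
      measureReal_mono (inter_subset_inter_left _ inter_subset_right) (mm_fin _ _ _)
    have e3 : volume (A ∩ NN A ∩ Icc (x-r) (x+r)) = ENNReal.ofReal (mm (A ∩ NN A) (x - r) (x + r)) := by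
      rw [mm, ofReal_measureReal (mm_fin _ _ _)]
    rw [e3, ← ENNReal.ofReal_div_of_pos (by linarith)]
    apply ENNReal.ofReal_le_ofReal
    rw [div_le_iff₀ (by linarith)]
    linarith
  have hfin := le_of_tendsto hx (Filter.eventually_of_mem self_mem_nhdsWithin fun r hr => hb r hr)
  have : (1:ENNReal) = ENNReal.ofReal 1 := by simp
  rw [this, ENNReal.ofReal_le_ofReal_iff (by norm_num)] at hfin
  norm_num at hfin

lemma schur {A : Set ℝ} (hm : MeasurableSet A) (hsf : SF A) (h1 : 1 ∈ closure A) {a x0 x1 ρ : ℝ}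
    (hρ' : 0 ≤ ρ) (hρ : ρ ≤ 1)
    (D : ∀ t, a ≤ t → t ≤ 1 → ρ * (1 - t) ≤ mm A t 1) (hx0 : x0 ∈ closure A)
    (ha : 1 / 3 + a / 3 ≤ x0) (hx : x0 ≤ x1) (hx1 : x1 ≤ 2 / 3) :
    mm A (3 * x0 - 1) (3 * x1 - 1) ≤ (1 - ρ) * (3 * (x1 - x0) - 3 * mm A x0 x1) := by
  set α := 3 * x0 - 1 with hα
  set β := 3 * x1 - 1 with hβ
  have hab : α ≤ β := by linarith
  have hN : mm (NN A) α β = 3 * mm A x0 x1 := by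
    rw [mm_NN, show (α + 1) / 3 = x0 by rw [hα]; ring, show (β + 1) / 3 = x1 by rw [hβ]; ring]
  refine le_of_forall_pos_le_add fun e he => ?_
  obtain ⟨K0, hK0s, hK0c, hK0⟩ := ((NN_meas hm).inter (measurableSet_Icc (a := α) (b := β))).exists_isCompact_lt_add
    (mm_fin _ _ _) (ε := ENNReal.ofReal e) (by simpa using he)
  set K : Set ℝ := K0 ∪ {α} with hK
  have hKc : IsCompact K := hK0c.union isCompact_singleton
  have hKs : K ⊆ Icc α β := by
    rintro t (ht | ht)
    · exact (hK0s ht).2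
    · rw [mem_singleton_iff] at ht; rw [ht]; exact ⟨le_refl _, hab⟩
  have hcl : ∀ p ∈ K, (p + 1) / 3 ∈ closure A := by
    rintro p (hp | hp)
    · have := (hK0s hp).1
      apply subset_closure
      have e : (p + 1) / 3 = 1 / 3 * p + 1 / 3 := by ring
      rw [e]; exact this
    · rw [mem_singleton_iff] at hp
      rw [hp, hα, show (3 * x0 - 1 + 1) / 3 = x0 by ring]; exact hx0
  have hC := comp_bound (X := A) (c := 1 - ρ) hKc (Or.inr rfl) hKs (by
    intro p hp v hpv hv
    have q1 := mm_P hm hsf (hcl p hp) hpv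
    rw [show 3 * ((p + 1) / 3) - v = 1 + p - v by ring,
      show 3 * ((p + 1) / 3) - p = 1 by ring] at q1
    have q2 := D (1 + p - v) (by have := (hKs hp).1; linarith) (by linarith)
    rw [← ENNReal.ofReal_mul (by linarith), ← ofReal_measureReal (mm_fin _ _ _)]
    apply ENNReal.ofReal_le_ofReal
    change mm A p v ≤ _
    nlinarith)
  -- real versions
  have hKm : MeasurableSet K := hKc.measurableSet
  have f1 : mm (NN A) α β ≤ volume.real K + e := by
    have : volume (NN A ∩ Icc α β) ≤ volume K + ENNReal.ofReal e :=
      hK0.le.trans (by gcongr; exact subset_union_left)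
    have h2 := ENNReal.toReal_mono (by simp [hKc.measure_lt_top.ne]) this
    rw [ENNReal.toReal_add hKc.measure_lt_top.ne (by simp), ENNReal.toReal_ofReal he.le] at h2
    exact h2
  have f2 : volume.real (A ∩ (Icc α β \ K)) ≤ (1 - ρ) * volume.real (Icc α β \ K) := by
    have hf : volume (Icc α β \ K) ≠ ⊤ :=
      ne_of_lt (lt_of_le_of_lt (measure_mono sdiff_subset) (by simp))
    have h2 := ENNReal.toReal_mono (ENNReal.mul_ne_top (by simp) hf) hC
    rw [ENNReal.toReal_mul, ENNReal.toReal_ofReal (by linarith)] at h2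
    exact h2
  have f3 : volume.real (Icc α β \ K) = (β - α) - volume.real K := by
    rw [measureReal_sdiff hKs hKm (by simp), Real.volume_real_Icc_of_le hab]
  have f4 : mm A α β ≤ volume.real (A ∩ (Icc α β \ K)) := by
    have hn := null_NN hm hsf h1
    have hsub : A ∩ Icc α β ⊆ (A ∩ (Icc α β \ K)) ∪ ((A ∩ NN A) ∪ {α}) := by
      rintro t ⟨ht, ht2⟩
      by_cases hk : t ∈ K
      · right
        rcases hk with hk | hk
        · left; exact ⟨ht, (hK0s hk).1⟩
        · right; exact hk
      · left; exact ⟨ht, ht2, hk⟩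
    have hz : volume ((A ∩ NN A) ∪ {α}) = 0 := by
      rw [measure_union_null_iff]; exact ⟨hn, by simp⟩
    have hf : volume (A ∩ (Icc α β \ K)) ≠ ⊤ :=
      ne_of_lt (lt_of_le_of_lt (measure_mono (inter_subset_right.trans sdiff_subset)) (by simp))
    have h2 : volume (A ∩ Icc α β) ≤ volume (A ∩ (Icc α β \ K)) :=
      (measure_mono hsub).trans ((measure_union_le _ _).trans (by rw [hz, add_zero]))
    exact ENNReal.toReal_mono hf h2
  rw [hN] at f1
  rw [f3] at f2
  have hρ0 : 0 ≤ 1 - ρ := by linarith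
  have g : (1 - ρ) * (β - α - volume.real K) ≤ (1 - ρ) * (3 * (x1 - x0) - 3 * mm A x0 x1 + e) :=
    mul_le_mul_of_nonneg_left (by rw [hα, hβ]; linarith) hρ0
  have g2 : 0 ≤ ρ * e := by positivity
  nlinarith

set_option maxHeartbeats 4000000 in
lemma lemS {A : Set ℝ} (hm : MeasurableSet A) (hsf : SF A) {a : ℝ} (h1c : 1 ∈ closure A)
    (hac : a ∈ closure A) (ha0 : 0 ≤ a) (ha2 : a < 1 / 2)
    (D : ∀ t, a ≤ t → t ≤ 1 → (77 / 177) * (1 - t) ≤ mm A t 1)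
    (hT : 1 / 3 ≤ mm A (2 / 9 + a / 3) 1) :
    mm A (2 / 3) 1 = 1 / 3 ∧ mm A (2 / 9 + a / 3) (2 / 3) = 0 := by
  have w1 := mm_W hm hsf hac (u := 2 / 3) (v := 1) (by norm_num)
  rw [show (2 / 3 + a) / 3 = 2 / 9 + a / 3 by ring, show (1 + a) / 3 = 1 / 3 + a / 3 by ring] at w1
  set M := 2 / 9 + a / 3 with hM
  set c0 := 1 / 3 + a / 3 with hc0
  have s1 : mm A M 1 = mm A M (2/3) + mm A (2/3) 1 := mm_add hm (by linarith) (by norm_num)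
  have s2 : mm A M (2/3) = mm A M c0 + mm A c0 (2/3) := mm_add hm (by linarith) (by linarith)
  have b1 := mm_le A (u := 2/3) (v := 1) (by norm_num)
  have n1 := mm_nonneg A M (2/3)
  have nc := mm_nonneg A c0 (2/3)
  have n2 := mm_nonneg A M c0
  have DM : a ≤ 1/3 → (77/177) * (7/9 - a/3) ≤ mm A M 1 := by
    intro h
    have := D M (by linarith) (by linarith)
    rw [hM] at this ⊢
    linarith
  set h := 1/3 - mm A (2/3) 1 with hh
  -- enough to show small
  by_contra hcon
  have key : (2/3) * h < mm A M (2/3) := by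
    by_contra hk
    push Not at hk
    exact hcon ⟨by linarith, by linarith⟩
  have hcpos : 0 < mm A c0 (2/3) := by linarith
  obtain ⟨l0, hl1, hl2, hl3, hl4, hl5⟩ := exists_right hm (by linarith) hcpos
  have s3 : mm A c0 (2/3) = mm A c0 l0 + mm A l0 (2/3) := mm_add hm hl1 hl2.le
  have sch := schur hm hsf h1c (by norm_num) (by norm_num) D hl5 hl1 hl2.le (le_refl _)
  rw [show (3 * (2/3) - 1 : ℝ) = 1 by norm_num] at sch
  have D1 := D (3 * l0 - 1) (by linarith) (by linarith)
  have hhb : h < 1/9 := by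
    by_cases h3 : a ≤ 1/3
    · have := DM h3; linarith
    · linarith
  have w2 := mm_W hm hsf h1c (u := 2 / 3) (v := 1) (by norm_num)
  rw [show ((2:ℝ) / 3 + 1) / 3 = 5/9 by ring, show ((1:ℝ) + 1) / 3 = 2/3 by ring] at w2
  by_cases hl9 : 5/9 ≤ l0
  · have := mm_mono A hl9 (le_refl (2/3:ℝ)); linarith
  push Not at hl9
  have s4 : mm A l0 (2/3) = mm A l0 (5/9) + mm A (5/9) (2/3) := mm_add hm hl9.le (by norm_num)
  rcases eq_or_lt_of_le (mm_nonneg A l0 (5/9)) with hz | hpos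
  · linarith
  obtain ⟨b, hb1, hb2, hb3, hb4, hb5⟩ := exists_left hm hl9.le hpos
  have s5 : mm A l0 (5/9) = mm A l0 b + mm A b (5/9) := mm_add hm hb1.le hb2
  -- b bound
  have hPb : 4/9 ≤ b → 2 * mm A (2/3) (3 * b - 2/3) ≤ 3 * b - 4/3 := by
    intro hb
    have := mm_P hm hsf hb5 (u := 2/3) (v := 3 * b - 2/3) (by linarith)
    rw [show 3 * b - (3 * b - 2/3) = 2/3 by ring] at this
    linarith
  have hb6 : b ≤ 4/9 + 2 * h / 3 := by
    by_cases hb : 4/9 ≤ b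
    · have q := hPb hb
      have s : mm A (2/3) 1 = mm A (2/3) (3*b-2/3) + mm A (3*b-2/3) 1 := mm_add hm (by linarith) (by linarith)
      have := mm_le A (u := 3*b-2/3) (v := 1) (by linarith)
      linarith
    · linarith
  -- delta
  obtain ⟨δ, hδ0, hδ1, hδ2, hδ3⟩ : ∃ δ, 0 ≤ δ ∧ δ ≤ 2 * h / 3 ∧ mm A (1 - 3 * δ) 1 ≤ 3 * δ / 2 ∧
      3 * mm A (5/9) (2/3) ≤ 3 * δ - mm A (1 - 3 * δ) 1 := by
    rcases eq_or_lt_of_le (mm_nonneg A (5/9) (2/3)) with hz | hp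
    · refine ⟨0, le_refl _, by linarith, ?_, ?_⟩
      · simp [mm_self]
      · simp [mm_self, ← hz]
    · obtain ⟨z, hz1, hz2, hz3, hz4, hz5⟩ := exists_right hm (by norm_num) hp
      have p1 := mm_P hm hsf hz5 (u := 3 * z - 1) (v := 1) (by linarith)
      rw [show 3 * z - (3 * z - 1) = 1 by ring] at p1
      have p2 := mm_W hm hsf h1c (u := 3 * z - 1) (v := 1) (by linarith)
      rw [show (3 * z - 1 + 1) / 3 = z by ring, show ((1:ℝ) + 1) / 3 = 2/3 by ring] at p2
      have s : mm A (2/3) 1 = mm A (2/3) (3*z-1) + mm A (3*z-1) 1 := mm_add hm (by linarith) (by linarith)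
      have q := mm_le A (u := 2/3) (v := 3*z-1) (by linarith)
      have s' : mm A (5/9) (2/3) = mm A (5/9) z + mm A z (2/3) := mm_add hm hz1 hz2.le
      refine ⟨2/3 - z, by linarith, by linarith, ?_, ?_⟩ <;>
        rw [show 1 - 3 * (2/3 - z) = 3 * z - 1 by ring] <;> linarith
  set h1 := 3 * δ - mm A (1 - 3 * δ) 1 with hh1
  have h1h : h1 ≤ h := by
    have s : mm A (2/3) 1 = mm A (2/3) (1-3*δ) + mm A (1-3*δ) 1 := mm_add hm (by linarith) (by linarith)
    have q := mm_le A (u := 2/3) (v := 1-3*δ) (by linarith)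
    linarith
  have heps : (3/2) * (b - 4/9) ≤ h - h1 := by
    by_cases hb : 4/9 ≤ b
    · have q := hPb hb
      by_cases hov : 3 * b - 2/3 ≤ 1 - 3 * δ
      · have s : mm A (2/3) 1 = mm A (2/3) (3*b-2/3) + mm A (3*b-2/3) 1 := mm_add hm (by linarith) (by linarith)
        have s' : mm A (3*b-2/3) 1 = mm A (3*b-2/3) (1-3*δ) + mm A (1-3*δ) 1 := mm_add hm (by linarith) (by linarith)
        have := mm_le A hov
        linarith
      · exfalso
        have s : mm A (2/3) 1 = mm A (2/3) (3*b-2/3) + mm A (3*b-2/3) 1 := mm_add hm (by linarith) (by linarith)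
        have := mm_mono A (le_of_not_ge hov) (le_refl 1)
        linarith
    · linarith
  have hb7 : b < 1/2 := by
    by_contra hb
    push Not at hb
    have sc := schur hm hsf h1c (by norm_num) (by norm_num) D hl5 hl1 hb1.le (by linarith)
    have p1 := mm_P hm hsf hb5 (u := 3 * b - 1) (v := 1) (by linarith)
    rw [show 3 * b - (3 * b - 1) = 1 by ring] at p1
    have s : mm A (3*l0-1) 1 = mm A (3*l0-1) (3*b-1) + mm A (3*b-1) 1 := mm_add hm (by linarith) (by linarith)
    by_cases h3 : a ≤ 1/3
    · have := DM h3; linarith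
    · linarith
  set q1 := 2/9 + b/3 with hq1
  have hqb : q1 < b := by linarith
  have hq1h : 3 * mm A q1 b < h := by
    have w := mm_W hm hsf hb5 (u := 2/3) (v := 2 * b) (by linarith)
    rw [show (2/3 + b)/3 = q1 by rw [hq1]; ring, show (2*b+b)/3 = b by ring] at w
    have hq0 : max l0 (3*b-1) < b := max_lt hb1 (by linarith)
    have e1 := le_max_left l0 (3*b-1)
    have e2 := le_max_right l0 (3*b-1)
    have pos := hb4 _ e1 hq0
    set q0 := max l0 (3*b-1)
    have p := mm_P hm hsf hb5 (u := 2 * b) (v := 3 * b - q0) (by linarith)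
    rw [show 3 * b - (3 * b - q0) = q0 by ring, show 3*b - 2*b = b by ring] at p
    have s : mm A (2/3) 1 = mm A (2/3) (2*b) + mm A (2*b) 1 := mm_add hm (by linarith) (by linarith)
    have s' : mm A (2*b) 1 = mm A (2*b) (3*b-q0) + mm A (3*b-q0) 1 := mm_add hm (by linarith) (by linarith)
    have := mm_le A (u := 3*b-q0) (v := 1) (by linarith)
    linarith
  by_cases hql : q1 ≤ l0
  · have := mm_mono A hql (le_refl b)
    linarith
  · push Not at hql
    have w := mm_W hm hsf hl5 (u := 2*l0) (v := 2/3+b-l0) (by linarith)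
    rw [show (2*l0 + l0)/3 = l0 by ring, show (2/3+b-l0+l0)/3 = q1 by rw [hq1]; ring] at w
    have s : mm A (2/3) 1 = mm A (2/3) (2*l0) + mm A (2*l0) 1 := mm_add hm (by linarith) (by linarith)
    have s' : mm A (2*l0) 1 = mm A (2*l0) (2/3+b-l0) + mm A (2/3+b-l0) 1 := mm_add hm (by linarith) (by linarith)
    have s'' : mm A (2/3+b-l0) 1 = mm A (2/3+b-l0) (1-3*δ) + mm A (1-3*δ) 1 := mm_add hm (by linarith) (by linarith)
    have s3 : mm A l0 b = mm A l0 q1 + mm A q1 b := mm_add hm hql.le hqb.le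
    have t1 := mm_le A (u := 2/3) (v := 2*l0) (by linarith)
    have t2 := mm_le A (u := 2/3+b-l0) (v := 1-3*δ) (by linarith)
    linarith

def scl (M : ℝ) (A : Set ℝ) : Set ℝ := (fun t : ℝ => M * t + 0) ⁻¹' A

lemma scl_meas {A : Set ℝ} (hm : MeasurableSet A) (M : ℝ) : MeasurableSet (scl M A) :=
  (by fun_prop : Measurable (fun t : ℝ => M * t + 0)) hm

lemma scl_SF {A : Set ℝ} (h : SF A) (M : ℝ) : SF (scl M A) := by
  intro x hx y hy z hz e
  refine h _ hx _ hy _ hz ?_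
  simp only
  linear_combination M * e

lemma scl_mm (A : Set ℝ) {M : ℝ} (hM : 0 < M) (u v : ℝ) :
    mm (scl M A) u v = mm A (M * u) (M * v) / M := by
  have e : scl M A ∩ Icc u v = (fun t : ℝ => M * t + 0) ⁻¹' (A ∩ Icc (M * u) (M * v)) := by
    ext t
    simp only [scl, mem_inter_iff, mem_preimage, mem_Icc, add_zero, mul_le_mul_iff_right₀ hM]
  unfold mm
  rw [e, vol_affine _ _ _ hM.ne', abs_of_pos (inv_pos.2 hM)]
  field_simp

lemma scl_cl {A : Set ℝ} {M x : ℝ} (hM : 0 < M) (h : M * x ∈ closure A) : x ∈ closure (scl M A) := by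
  rw [Metric.mem_closure_iff] at h ⊢
  intro e he
  obtain ⟨y, hy, hd⟩ := h (M * e) (by positivity)
  refine ⟨y / M, ?_, ?_⟩
  · show M * (y / M) + 0 ∈ A
    rw [show M * (y / M) + 0 = y by field_simp; ring]; exact hy
  · rw [Real.dist_eq] at *
    rw [show M * x - y = M * (x - y / M) by field_simp, abs_mul, abs_of_pos hM] at hd
    exact lt_of_mul_lt_mul_left hd hM.le

lemma lemE {A : Set ℝ} (hm : MeasurableSet A) (hsf : SF A) {α v : ℝ} (hα : α ∈ closure A)
    (h1 : v / 2 ≤ α) (h2 : α ≤ 2 * v / 3) : mm A α v ≤ α / 2 := by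
  have p := mm_P hm hsf hα (u := 3 * α - v) (v := v) (by linarith)
  rw [show 3 * α - (3 * α - v) = v by ring] at p
  have s : mm A α v = mm A α (3 * α - v) + mm A (3 * α - v) v := mm_add hm (by linarith) (by linarith)
  have := mm_le A (u := α) (v := 3 * α - v) (by linarith)
  linarith

lemma one_cl {A : Set ℝ} (hm : MeasurableSet A) {a ρ : ℝ} (hρ : 0 < ρ) (ha : a < 1)
    (D : ∀ t, a ≤ t → t ≤ 1 → ρ * (1 - t) ≤ mm A t 1) : 1 ∈ closure A := by
  have d := D a (le_refl _) ha.le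
  have : 0 < ρ * (1 - a) := mul_pos hρ (by linarith)
  obtain ⟨b, hb1, hb2, hb3, hb4, hb5⟩ := exists_left hm ha.le (this.trans_le d)
  have d2 := D b hb1.le hb2
  rw [hb3] at d2
  rcases eq_or_lt_of_le hb2 with e | e
  · rwa [e] at hb5
  · have : 0 < ρ * (1 - b) := mul_pos hρ (by linarith)
    linarith

lemma lemF1 {A : Set ℝ} (hm : MeasurableSet A) (hsf : SF A) {a : ℝ} (hac : a ∈ closure A)
    (ha0 : 0 ≤ a) (ha1 : a < 1) (hz : mm A 0 a = 0)
    (hmax : ∀ t, a ≤ t → t ≤ 1 → mm A 0 t - 81 / 177 * t ≤ mm A 0 1 - 81 / 177)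
    (hv : -(27 / 177) * a ≤ mm A 0 1 - 81 / 177) :
    a = 4 / 21 ∧ mm A a (2 / 7) = 2 / 7 - a ∧ mm A (2 / 3) 1 = 1 / 3 ∧ mm A 0 1 = 3 / 7 := by
  have D : ∀ t, a ≤ t → t ≤ 1 → (81 / 177) * (1 - t) ≤ mm A t 1 := by
    intro t h1 h2
    have s : mm A 0 1 = mm A 0 t + mm A t 1 := mm_add hm (by linarith) h2
    have := hmax t h1 h2
    linarith
  have D' : ∀ t, a ≤ t → t ≤ 1 → (77 / 177) * (1 - t) ≤ mm A t 1 := by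
    intro t h1 h2
    have := D t h1 h2
    linarith
  have h1c := one_cl hm (by norm_num) ha1 D
  have s0 : mm A 0 1 = mm A 0 a + mm A a 1 := mm_add hm ha0 ha1.le
  have ha2 : a < 1 / 2 := by
    by_contra h
    push Not at h
    by_cases h3 : a ≤ 2/3
    · have := lemE hm hsf hac (v := 1) h (by linarith); linarith
    · have := mm_le A ha1.le; linarith
  have S := lemS hm hsf h1c hac ha0 ha2 D'
  have s1 : mm A (2 / 9 + a / 3) 1 = mm A (2 / 9 + a / 3) (2/3) + mm A (2/3) 1 :=
    mm_add hm (by linarith) (by norm_num)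
  have s2 : mm A 0 1 = mm A 0 (2 / 9 + a / 3) + mm A (2 / 9 + a / 3) 1 :=
    mm_add hm (by linarith) (by linarith)
  by_cases c1 : a < 4/27
  · exfalso
    have d := D (2 / 9 + a / 3) (by linarith) (by linarith)
    obtain ⟨e1, e2⟩ := S (by linarith)
    linarith
  by_cases c2 : 1/3 ≤ a
  · exfalso
    have := mm_mono A (le_refl (0:ℝ)) (show 2 / 9 + a / 3 ≤ a by linarith)
    obtain ⟨e1, e2⟩ := S (by linarith)
    linarith
  push Not at c1 c2
  have s3 : mm A 0 (2 / 9 + a / 3) = mm A 0 a + mm A a (2 / 9 + a / 3) :=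
    mm_add hm ha0 (by linarith)
  have L1 : mm A a (2 / 9 + a / 3) ≤ 2/27 + a/9 := by
    by_cases c3 : a ≤ 2 * (2 / 9 + a / 3) / 3
    · have := lemE hm hsf hac (v := 2 / 9 + a / 3) (by linarith) c3; linarith
    · have := mm_le A (u := a) (v := 2 / 9 + a / 3) (by linarith); linarith
  have L2 := mm_le A (u := a) (v := 2 / 9 + a / 3) (by linarith)
  obtain ⟨e1, e2⟩ := S (by
    by_cases c : a ≤ 4/21
    · linarith
    · linarith)
  have ea : a = 4/21 := by linarith
  have eM : 2 / 9 + a / 3 = 2 / 7 := by rw [ea]; norm_num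
  rw [eM] at L2 s3 s2 s1 e2
  exact ⟨ea, by linarith, e1, by linarith⟩

lemma lemF2 {A : Set ℝ} (hm : MeasurableSet A) (hsf : SF A) {a M : ℝ} (hac : a ∈ closure A)
    (ha0 : 0 ≤ a) (ha1 : a < M) (hz : mm A 0 a = 0)
    (hmax : ∀ t, a ≤ t → t ≤ M → mm A 0 t - 81 / 177 * t ≤ mm A 0 M - 81 / 177 * M)
    (hv : -(27 / 177) * a ≤ mm A 0 M - 81 / 177 * M) :
    a = 4 * M / 21 ∧ mm A a (2 * M / 7) = 2 * M / 7 - a ∧ mm A (2 * M / 3) M = M / 3 ∧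
      mm A 0 M = 3 * M / 7 := by
  have hM : 0 < M := by linarith
  have ea : M * (a / M) = a := by field_simp
  obtain ⟨e1, e2, e3, e4⟩ := lemF1 (scl_meas hm M) (scl_SF hsf M) (a := a / M)
    (scl_cl hM (by rw [ea]; exact hac)) (by positivity) (by rw [div_lt_one hM]; exact ha1)
    (by rw [scl_mm A hM, ea, mul_zero, hz, zero_div])
    (by
      intro t h1 h2
      rw [div_le_iff₀ hM] at h1
      have := hmax (M * t) (by linarith) (by nlinarith)
      rw [scl_mm A hM, scl_mm A hM, mul_zero, mul_one, sub_le_iff_le_add, div_le_iff₀ hM]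
      have e : (mm A 0 M / M - 81 / 177 + 81 / 177 * t) * M = mm A 0 M - 81/177 * M + 81/177 * (M * t) := by
        field_simp
      rw [e]; linarith)
    (by
      rw [scl_mm A hM, mul_zero, mul_one, le_sub_iff_add_le, le_div_iff₀ hM]
      have e : (-(27 / 177) * (a / M) + 81 / 177) * M = -(27/177) * a + 81/177 * M := by
        field_simp
      rw [e]; linarith)
  rw [scl_mm A hM, div_eq_iff hM.ne'] at e2 e3 e4
  rw [ea, show M * (2/7) = 2 * M / 7 by ring] at e2
  rw [show M * (2/3) = 2 * M / 3 by ring, mul_one] at e3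
  rw [mul_zero, mul_one] at e4
  rw [div_eq_iff hM.ne'] at e1
  refine ⟨by linarith, ?_, by linarith, by linarith⟩
  rw [e2, sub_mul, div_mul_cancel₀ _ hM.ne']; ring

lemma lemF {A : Set ℝ} (hm : MeasurableSet A) (hsf : SF A) {a M : ℝ} (hac : a ∈ closure A)
    (ha0 : 0 ≤ a) (ha1 : a < M) (hM1 : M ≤ 1) (hz : mm A 0 a = 0)
    (hv : -(27 / 177) * a ≤ mm A 0 M - 81 / 177 * M) :
    a = 4 * M / 21 ∧ mm A a (2 * M / 7) = 2 * M / 7 - a ∧ mm A (2 * M / 3) M = M / 3 ∧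
      mm A 0 M = 3 * M / 7 := by
  obtain ⟨M1, hM1s, hmax⟩ := (isCompact_Icc (a := a) (b := 1)).exists_isMaxOn ⟨a, le_refl _, by linarith⟩
    (f := fun t => mm A 0 t - 81/177 * t)
    ((mm_cont_right A 0).sub (continuous_const.mul continuous_id)).continuousOn
  have hmax' : ∀ t, a ≤ t → t ≤ 1 → mm A 0 t - 81/177 * t ≤ mm A 0 M1 - 81/177 * M1 :=
    fun t h1 h2 => hmax ⟨h1, h2⟩
  have g := hmax' M ha1.le hM1
  apply lemF2 hm hsf hac ha0 ha1 hz _ hv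
  intro t h1 h2
  refine (hmax' t h1 (by linarith)).trans ?_
  rcases eq_or_lt_of_le hM1s.1 with e | e
  · rw [← e, hz]; rw [← e, hz] at g; linarith
  · obtain ⟨f1, f2, f3, f4⟩ := lemF2 hm hsf hac ha0 e hz
      (fun t h1 h2 => hmax' t h1 (h2.trans hM1s.2)) (by linarith)
    linarith

lemma lemG {A : Set ℝ} (hm : MeasurableSet A) (hsf : SF A) (hv : 77/177 ≤ mm A 0 1)
    (hmax : ∀ t, 0 ≤ t → t ≤ 1 → mm A 0 t - 77/177 * t ≤ mm A 0 1 - 77/177) :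
    mm A 0 1 = 77/177 ∧ mm A (8/177) (12/177) = 4/177 ∧ mm A (28/177) (42/177) = 14/177 ∧
      mm A (2/3) 1 = 1/3 := by
  obtain ⟨a, ha0, ha1, hz, -, hac⟩ := exists_right hm (zero_le_one) (show 0 < mm A 0 1 by linarith)
  have D : ∀ t, a ≤ t → t ≤ 1 → (77 / 177) * (1 - t) ≤ mm A t 1 := by
    intro t h1 h2
    have s : mm A 0 1 = mm A 0 t + mm A t 1 := mm_add hm (by linarith) h2
    have := hmax t (by linarith) h2
    linarith
  have h1c := one_cl hm (by norm_num) ha1 D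
  have s0 : mm A 0 1 = mm A 0 a + mm A a 1 := mm_add hm ha0 ha1.le
  have ha2 : a < 1 / 2 := by
    by_contra h
    push Not at h
    by_cases h3 : a ≤ 2/3
    · have := lemE hm hsf hac (v := 1) h (by linarith); linarith
    · have := mm_le A ha1.le; linarith
  have S := lemS hm hsf h1c hac ha0 ha2 D
  have s1 : mm A (2 / 9 + a / 3) 1 = mm A (2 / 9 + a / 3) (2/3) + mm A (2/3) 1 :=
    mm_add hm (by linarith) (by norm_num)
  have s2 : mm A 0 1 = mm A 0 (2 / 9 + a / 3) + mm A (2 / 9 + a / 3) 1 :=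
    mm_add hm (by linarith) (by linarith)
  by_cases c2 : 1/3 ≤ a
  · exfalso
    have := mm_mono A (le_refl (0:ℝ)) (show 2 / 9 + a / 3 ≤ a by linarith)
    obtain ⟨e1, e2⟩ := S (by linarith)
    linarith
  push Not at c2
  by_cases c3 : mm A 0 (2 / 9 + a / 3) < 18/177
  · exfalso
    obtain ⟨e1, e2⟩ := S (by linarith)
    linarith
  push Not at c3
  obtain ⟨f1, f2, f3, f4⟩ := lemF hm hsf (M := 2 / 9 + a / 3) hac ha0 (by linarith) (by linarith) hz (by linarith)
  have ea : a = 8/177 := by linarith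
  rw [ea] at f2 f3 f4 S s1 s2
  norm_num at f2 f3 f4 S s1 s2 ⊢
  obtain ⟨e1, e2⟩ := S (by linarith)
  exact ⟨by linarith, by linarith, by linarith, by linarith⟩

lemma mm_full {A : Set ℝ} (hm : MeasurableSet A) {u v p q : ℝ} (h : mm A u v = v - u)
    (h1 : u ≤ p) (h2 : p ≤ q) (h3 : q ≤ v) : mm A p q = q - p := by
  have s1 : mm A u v = mm A u p + mm A p v := mm_add hm h1 (by linarith)
  have s2 : mm A p v = mm A p q + mm A q v := mm_add hm h2 h3
  have := mm_le A h1
  have := mm_le A h2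
  have := mm_le A h3
  linarith

lemma no_ov {A : Set ℝ} (hm : MeasurableSet A) (hsf : SF A) {u v p q x : ℝ} (h : mm A u v = v - u)
    (h' : mm A p q = q - p) (hx : x ∈ A) (a1 : u < v) (a2 : p < q) (a3 : 3 * p - x < v)
    (a4 : u < 3 * q - x) : False := by
  have hl : max u (3 * p - x) < min v (3 * q - x) :=
    max_lt (lt_min a1 a4) (lt_min a3 (by linarith))
  have e1 := le_max_left u (3 * p - x)
  have e2 := le_max_right u (3 * p - x)
  have e3 := min_le_left v (3 * q - x)
  have e4 := min_le_right v (3 * q - x)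
  set s := max u (3 * p - x)
  set t := min v (3 * q - x)
  have w := mm_W0 hm hsf hx hl.le
  rw [mm_full hm h e1 hl.le e3, mm_full hm h' (by linarith) (by linarith) (by linarith)] at w
  linarith

/-- **Theorem 2 (inverse theorem).** If `A` is a measurable 3-sum-free subset of `[0,1]`
of measure exactly `77/177`, then `A` is contained in one of the seven maximal extremal
sets `𝒜₀ ∪ {x, y, z}`, where `x, y, z` are chosen endpoints of the three intervals of
`𝒜₀`, the choice `(8/177, 14/59, 2/3)` being excluded. -/
theorem subset_extremal_of_three_sum_free_max_measure (A : Set ℝ)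
    (hA : A ⊆ Icc (0 : ℝ) 1) (hmeas : MeasurableSet A)
    (hsf : ∀ x ∈ A, ∀ y ∈ A, ∀ z ∈ A, x + y ≠ 3 * z)
    (hμ : volume A = 77 / 177) :
    ∃ x ∈ ({8/177, 4/59} : Set ℝ), ∃ y ∈ ({28/177, 14/59} : Set ℝ),
      ∃ z ∈ ({2/3, 1} : Set ℝ), (x, y, z) ≠ ((8/177 : ℝ), (14/59 : ℝ), (2/3 : ℝ)) ∧
        A ⊆ (Ioo (8/177 : ℝ) (4/59) ∪ Ioo (28/177 : ℝ) (14/59) ∪ Ioo (2/3 : ℝ) 1)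
          ∪ {x, y, z} := by
  have hs : SF A := hsf
  have h01 : mm A 0 1 = 77/177 := by
    rw [mm, inter_eq_left.2 hA, measureReal_def, hμ]; simp
  obtain ⟨s, hs01, hmax⟩ := (isCompact_Icc (a := (0:ℝ)) (b := 1)).exists_isMaxOn ⟨0, by simp⟩
    (f := fun t => mm A 0 t - 77/177 * t)
    ((mm_cont_right A 0).sub (continuous_const.mul continuous_id)).continuousOn
  have hmax' : ∀ t, 0 ≤ t → t ≤ 1 → mm A 0 t - 77/177 * t ≤ mm A 0 s - 77/177 * s :=
    fun t h1 h2 => hmax ⟨h1, h2⟩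
  have hsle : mm A 0 s - 77/177 * s ≤ 0 := by
    by_contra hc
    push Not at hc
    have hs0 : 0 < s := by
      rcases eq_or_lt_of_le hs01.1 with e | e
      · rw [← e, mm_self] at hc; simp at hc
      · exact e
    have e1 : mm (scl s A) 0 1 = mm A 0 s / s := by rw [scl_mm A hs0, mul_zero, mul_one]
    have hgt : 77/177 < mm (scl s A) 0 1 := by
      rw [e1, lt_div_iff₀ hs0]; linarith
    have := lemG (scl_meas hmeas s) (scl_SF hs s) hgt.le (by
      intro t h1 h2
      have := hmax' (s * t) (by positivity) (by nlinarith [hs01.2])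
      rw [e1, scl_mm A hs0, mul_zero, sub_le_iff_le_add, div_le_iff₀ hs0]
      have e : (mm A 0 s / s - 77 / 177 + 77 / 177 * t) * s = mm A 0 s - 77/177 * s + 77/177 * (s * t) := by
        field_simp
      rw [e]; linarith)
    linarith [this.1]
  obtain ⟨-, f1, f2, f3⟩ := lemG hmeas hs h01.ge (fun t h1 h2 => by
    have := hmax' t h1 h2; linarith)
  have f1' : mm A (8/177) (12/177) = 12/177 - 8/177 := by rw [f1]; norm_num
  have f2' : mm A (28/177) (42/177) = 42/177 - 28/177 := by rw [f2]; norm_num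
  have f3' : mm A (2/3) 1 = 1 - 2/3 := by rw [f3]; norm_num
  have loc : ∀ x ∈ A, (8/177 ≤ x ∧ x ≤ 12/177) ∨ (28/177 ≤ x ∧ x ≤ 42/177) ∨ (2/3 ≤ x ∧ x ≤ 1) := by
    intro x hx
    have hx01 := hA hx
    have g0 := hx01.1
    have g1 := hx01.2
    by_cases c1 : x < 8/177
    · exact (no_ov hmeas hs f3' f2' hx (by norm_num) (by norm_num) (by linarith) (by linarith)).elim
    by_cases c2 : x ≤ 12/177
    · exact Or.inl ⟨by linarith, c2⟩
    by_cases c3 : x < 28/177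
    · exact (no_ov hmeas hs f1' f1' hx (by norm_num) (by norm_num) (by linarith) (by linarith)).elim
    by_cases c4 : x ≤ 42/177
    · exact Or.inr (Or.inl ⟨by linarith, c4⟩)
    by_cases c5 : x < 98/177
    · exact (no_ov hmeas hs f2' f2' hx (by norm_num) (by norm_num) (by linarith) (by linarith)).elim
    by_cases c6 : x < 2/3
    · exact (no_ov hmeas hs f1' f2' hx (by norm_num) (by norm_num) (by linarith) (by linarith)).elim
    · exact Or.inr (Or.inr ⟨by linarith, g1⟩)
  classical
  refine ⟨if (8/177 : ℝ) ∈ A then 8/177 else 4/59, ?_, if (14/59 : ℝ) ∈ A then 14/59 else 28/177, ?_,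
    if (2/3 : ℝ) ∈ A then 2/3 else 1, ?_, ?_, ?_⟩
  · split_ifs <;> simp
  · split_ifs <;> simp
  · split_ifs <;> simp
  · intro he
    simp only [Prod.mk.injEq] at he
    obtain ⟨e1, e2, e3⟩ := he
    have m1 : (8/177 : ℝ) ∈ A := by
      by_contra hn; rw [if_neg hn] at e1; norm_num at e1
    have m2 : (14/59 : ℝ) ∈ A := by
      by_contra hn; rw [if_neg hn] at e2; norm_num at e2
    have m3 : (2/3 : ℝ) ∈ A := by
      by_contra hn; rw [if_neg hn] at e3; norm_num at e3
    exact hsf _ m1 _ m3 _ m2 (by norm_num)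
  · intro t ht
    rcases loc t ht with ⟨h1, h2⟩ | ⟨h1, h2⟩ | ⟨h1, h2⟩
    · rcases eq_or_lt_of_le h1 with e | e
      · right; left; rw [if_pos (e ▸ ht)]; exact e.symm
      rcases eq_or_lt_of_le h2 with e' | e'
      · right; left
        rw [if_neg (fun hn => hsf t ht t ht _ hn (by rw [e']; norm_num)), e']; norm_num
      · left; left; left; exact ⟨e, by linarith⟩
    · rcases eq_or_lt_of_le h2 with e | e
      · have e' : t = 14/59 := by rw [e]; norm_num
        right; right; left; rw [if_pos (e' ▸ ht)]; exact e'
      rcases eq_or_lt_of_le h1 with e' | e'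
      · right; right; left
        rw [if_neg (fun hn => hsf _ hn _ hn t ht (by rw [← e']; norm_num)), e']
      · left; left; right; exact ⟨e', by linarith⟩
    · rcases eq_or_lt_of_le h1 with e | e
      · right; right; right; rw [mem_singleton_iff, if_pos (e ▸ ht)]; exact e.symm
      rcases eq_or_lt_of_le h2 with e' | e'
      · right; right; right
        rw [mem_singleton_iff, if_neg (fun hn => hsf t ht t ht _ hn (by rw [e']; norm_num)), e']
      · left; right; exact ⟨e, e'⟩
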